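/- arXiv:1505.01016 — 2 statements merged into one kernel-verified Lean document; each statement's English description precedes it below -/
import Mathlib

section
/- For the K-receiver memoryless erasure broadcast channel with input alphabet {0,1}^F and erasure probabilities 1 > δ_1 ≥ δ_2 ≥ ... ≥ δ_K ≥ 0, the degraded message set capacity region 𝒞† equals the set of all nonnegative tuples (R_{{1,...,K}}, R_{{2,...,K}}, ..., R_{{K}}) satisfying Σ_{k=1}^K R_{{k,...,K}} / ( F·(1-δ_k) ) ≤ 1. -/
open scoped BigOperators
open Classical

/-- Channel input alphabet: `F`-bit packets. -/
abbrev Packet (F : ℕ) := Fin F → Bool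

/-- For the `K`-receiver memoryless erasure broadcast channel with erasure
probabilities `δ`, a code with message sets `Fin (m k)` (the `k`-th message must be
decoded by every receiver in `{k,…,K}`), encoder `f` and decoders `φ` (receiver `j`
outputs an estimate of every message): `degErrProb … j k` is the probability that
receiver `j` decodes message `k` incorrectly, when all messages are independent and
uniform and the erasures of receiver `j` are i.i.d. Bernoulli(`δ j`) independent of
the messages.  (Only the channel's marginals matter for these error probabilities.) -/
noncomputable def degErrProb (K F n : ℕ) (δ : Fin K → ℝ) (m : Fin K → ℕ)
    (f : (∀ k : Fin K, Fin (m k)) → Fin n → Packet F)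
    (φ : Fin K → (Fin n → Option (Packet F)) → ∀ k : Fin K, Fin (m k))
    (j k : Fin K) : ℝ :=
  ∑ w : ∀ i : Fin K, Fin (m i), ∑ e : Fin n → Bool,
    ((∏ i : Fin K, (1 : ℝ) / (m i)) *
        ∏ t : Fin n, (if e t then δ j else 1 - δ j)) *
      (if φ j (fun t => if e t then none else some (f w t)) k ≠ w k then 1 else 0)

/-- A rate tuple `(R_{{1,…,K}}, …, R_{{K}})` (the `k`-th component being the rate of
the message that must be decoded by receivers `k,…,K`) is achievable with degraded
message sets if for every `ε > 0` there are a blocklength `n`, message sets of sizes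
`m k ≥ 2^{n (R_k - ε)}`, an encoder and `K` decoders such that every receiver
`j ∈ {k,…,K}` decodes message `k` with error probability at most `ε`. -/
def DegAchievable (K F : ℕ) (δ : Fin K → ℝ) (R : Fin K → ℝ) : Prop :=
  ∀ ε : ℝ, 0 < ε →
    ∃ (n : ℕ), 0 < n ∧
      ∃ (m : Fin K → ℕ)
        (f : (∀ k : Fin K, Fin (m k)) → Fin n → Packet F)
        (φ : Fin K → (Fin n → Option (Packet F)) → ∀ k : Fin K, Fin (m k)),
        (∀ k : Fin K, (2 : ℝ) ^ ((n : ℝ) * (R k - ε)) ≤ (m k : ℝ)) ∧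
        (∀ j k : Fin K, k ≤ j → degErrProb K F n δ m f φ j k ≤ ε)

/-! ### Means over random subsets -/

/-- The mean of `h` over the random subset of `A` that contains each element independently with
probability `p`. -/
noncomputable def bernoulliMean {ι : Type*} [DecidableEq ι] (A : Finset ι) (p : ℝ)
    (h : Finset ι → ℝ) : ℝ :=
  ∑ S ∈ A.powerset, (∏ t ∈ A, if t ∈ S then p else 1 - p) * h S

section BernoulliMean

variable {ι : Type*} [DecidableEq ι]

theorem bernoulliMean_empty (p : ℝ) (h : Finset ι → ℝ) : bernoulliMean ∅ p h = h ∅ := by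
  simp [bernoulliMean]

theorem bernoulliMean_insert {a : ι} {A : Finset ι} (ha : a ∉ A) (p : ℝ) (h : Finset ι → ℝ) :
    bernoulliMean (insert a A) p h =
      (1 - p) * bernoulliMean A p h + p * bernoulliMean A p (fun S => h (insert a S)) := by
  unfold bernoulliMean
  rw [Finset.sum_powerset_insert ha, Finset.mul_sum, Finset.mul_sum]
  congr 1
  · refine Finset.sum_congr rfl fun S hS => ?_
    have haS : a ∉ S := fun h => ha (Finset.mem_powerset.1 hS h)
    rw [Finset.prod_insert ha, if_neg haS, mul_assoc]
  · refine Finset.sum_congr rfl fun S hS => ?_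
    rw [Finset.prod_insert ha, if_pos (Finset.mem_insert_self a S), mul_assoc]
    congr 2
    refine Finset.prod_congr rfl fun t ht => ?_
    have hta : t ≠ a := fun h => ha (h ▸ ht)
    simp [hta]

theorem bernoulliMean_add (A : Finset ι) (p : ℝ) (g h : Finset ι → ℝ) :
    bernoulliMean A p (fun S => g S + h S) = bernoulliMean A p g + bernoulliMean A p h := by
  simp [bernoulliMean, mul_add, Finset.sum_add_distrib]

theorem bernoulliMean_sub (A : Finset ι) (p : ℝ) (g h : Finset ι → ℝ) :
    bernoulliMean A p (fun S => g S - h S) = bernoulliMean A p g - bernoulliMean A p h := by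
  simp [bernoulliMean, mul_sub, Finset.sum_sub_distrib]

theorem bernoulliMean_const_mul (A : Finset ι) (p c : ℝ) (h : Finset ι → ℝ) :
    bernoulliMean A p (fun S => c * h S) = c * bernoulliMean A p h := by
  simp only [bernoulliMean, Finset.mul_sum]
  exact Finset.sum_congr rfl fun S _ => by ring

theorem bernoulliMean_const (A : Finset ι) (p c : ℝ) : bernoulliMean A p (fun _ => c) = c := by
  induction A using Finset.induction_on with
  | empty => exact bernoulliMean_empty p _
  | insert a A ha ih => rw [bernoulliMean_insert ha, ih]; ring

theorem bernoulliMean_mono (A : Finset ι) {p : ℝ} (hp0 : 0 ≤ p) (hp1 : p ≤ 1)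
    {g h : Finset ι → ℝ} (hgh : ∀ S, g S ≤ h S) : bernoulliMean A p g ≤ bernoulliMean A p h := by
  refine Finset.sum_le_sum fun S _ => mul_le_mul_of_nonneg_left (hgh S) ?_
  refine Finset.prod_nonneg fun t _ => ?_
  split_ifs <;> linarith

/-- The mean of an antitone set function decreases with the inclusion probability. -/
theorem bernoulliMean_le_of_antitone (A : Finset ι) {p q : ℝ} (hp0 : 0 ≤ p) (hpq : p ≤ q)
    (hq1 : q ≤ 1) {h : Finset ι → ℝ} (hh : Antitone h) :
    bernoulliMean A q h ≤ bernoulliMean A p h := by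
  induction A using Finset.induction_on generalizing h with
  | empty => simp [bernoulliMean_empty]
  | insert a A ha ih =>
    rw [bernoulliMean_insert ha, bernoulliMean_insert ha]
    have h1 := ih hh
    have h2 : bernoulliMean A q (fun S => h (insert a S)) ≤
        bernoulliMean A p (fun S => h (insert a S)) :=
      ih fun S T hST => hh (Finset.insert_subset_insert a hST)
    have h3 : bernoulliMean A p (fun S => h (insert a S)) ≤ bernoulliMean A p h :=
      bernoulliMean_mono A hp0 (hpq.trans hq1) fun S => hh (Finset.subset_insert a S)
    nlinarith [mul_le_mul_of_nonneg_left h1 (sub_nonneg.2 hq1),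
      mul_le_mul_of_nonneg_left h2 (hp0.trans hpq), mul_le_mul_of_nonneg_left h3 (sub_nonneg.2 hpq)]

/-- For a set function with diminishing returns, the mean divided by the inclusion probability
decreases with the inclusion probability. -/
theorem mul_bernoulliMean_le (A : Finset ι) {p q : ℝ} (hp0 : 0 ≤ p) (hpq : p ≤ q)
    (hq1 : q ≤ 1) {h : Finset ι → ℝ} (h0 : 0 ≤ h ∅)
    (hh : ∀ a, Antitone fun S => h (insert a S) - h S) :
    p * bernoulliMean A q h ≤ q * bernoulliMean A p h := by
  induction A using Finset.induction_on with
  | empty => simpa [bernoulliMean_empty] using mul_le_mul_of_nonneg_right hpq h0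
  | insert a A ha ih =>
    have h1 := bernoulliMean_le_of_antitone A hp0 hpq hq1 (hh a)
    rw [bernoulliMean_sub, bernoulliMean_sub] at h1
    rw [bernoulliMean_insert ha, bernoulliMean_insert ha]
    nlinarith [mul_le_mul_of_nonneg_left h1 (mul_nonneg hp0 (hp0.trans hpq))]

theorem bernoulliMean_le_card (A : Finset ι) {p c : ℝ} (hp0 : 0 ≤ p) (hp1 : p ≤ 1)
    {h : Finset ι → ℝ} (h0 : h ∅ ≤ 0) (hh : ∀ a S, h (insert a S) - h S ≤ c) :
    bernoulliMean A p h ≤ p * (A.card * c) := by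
  induction A using Finset.induction_on with
  | empty => simpa [bernoulliMean_empty] using h0
  | insert a A ha ih =>
    have h1 := bernoulliMean_mono A hp0 hp1 (hh a)
    rw [bernoulliMean_const, bernoulliMean_sub] at h1
    rw [bernoulliMean_insert ha, Finset.card_insert_of_notMem ha]
    push_cast
    nlinarith [mul_le_mul_of_nonneg_left h1 hp0]

theorem bernoulliMean_univ [Fintype ι] (p : ℝ) (h : Finset ι → ℝ) :
    bernoulliMean Finset.univ p h =
      ∑ e : ι → Bool, (∏ t, if e t then 1 - p else p) * h {t | e t = false} := by
  unfold bernoulliMean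
  rw [Finset.powerset_univ]
  symm
  refine Finset.sum_bij' (fun e _ => ({t | e t = false} : Finset ι))
    (fun S _ => fun t => decide (t ∉ S)) (by simp) (by simp) ?_ ?_ ?_
  · intro e _
    ext t
    simp
  · intro S _
    ext t
    simp
  · intro e _
    congr 1
    refine Finset.prod_congr rfl fun t _ => ?_
    by_cases h : e t <;> simp [h]

end BernoulliMean

/-! ### Entropy of functions of a uniform variable -/

/-- The number of points at which `X` takes the value `a`. -/
noncomputable def fiberCount {Ω α : Type*} [Fintype Ω] (X : Ω → α) (a : α) : ℝ :=
  (Finset.card {ω | X ω = a} : ℝ)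

/-- The sum over `ω` of the logarithm of the size of the level set of `X` through `ω`. The Shannon
entropy of `X` under the uniform law is `log |Ω| - logFiber X / |Ω|`. -/
noncomputable def logFiber {Ω α : Type*} [Fintype Ω] (X : Ω → α) : ℝ :=
  ∑ ω, Real.log (fiberCount X (X ω))

section LogFiber

variable {Ω α β γ : Type*} [Fintype Ω]

theorem logFiber_congr {X : Ω → α} {Y : Ω → β} (h : ∀ ω ω', X ω' = X ω ↔ Y ω' = Y ω) :
    logFiber X = logFiber Y := by
  simp only [logFiber, fiberCount, h]

theorem fiberCount_nonneg (X : Ω → α) (a : α) : 0 ≤ fiberCount X a :=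
  Nat.cast_nonneg _

theorem fiberCount_pos (X : Ω → α) (ω : Ω) : 0 < fiberCount X (X ω) :=
  Nat.cast_pos.2 (Finset.card_pos.2 ⟨ω, by simp⟩)

theorem sum_fiberCount_pair [Fintype β] (V : Ω → α) (W : Ω → β) (v : α) :
    ∑ w, fiberCount (fun ω => (V ω, W ω)) (v, w) = fiberCount V v := by
  have h := Finset.card_eq_sum_card_fiberwise (s := ({ω | V ω = v} : Finset Ω)) (f := W)
    (t := Finset.univ) (fun _ _ => by simp)
  unfold fiberCount
  rw [h]
  push_cast
  refine Finset.sum_congr rfl fun w _ => ?_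
  rw [Finset.filter_filter]
  simp only [Prod.mk.injEq]

theorem logFiber_pair_le (V : Ω → α) (W : Ω → β) :
    logFiber (fun ω => (V ω, W ω)) ≤ logFiber V := by
  refine Finset.sum_le_sum fun ω _ =>
    Real.log_le_log (fiberCount_pos (fun ω => (V ω, W ω)) ω) ?_
  refine Nat.cast_le.2 (Finset.card_le_card fun ω' => ?_)
  simp +contextual

/-- Gibbs' inequality for the conditional entropy of `W` given `V`. -/
theorem logFiber_sub_pair_le [Fintype β] (V : Ω → α) (W : Ω → β) (q : α → β → ℝ)
    (hq : ∀ v w, 0 ≤ q v w) (hpos : ∀ ω, 0 < q (V ω) (W ω))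
    (hsum : ∀ ω, ∑ w, q (V ω) w ≤ 1) :
    logFiber V - logFiber (fun ω => (V ω, W ω)) ≤ ∑ ω, -Real.log (q (V ω) (W ω)) := by
  set P : Ω → α × β := fun ω => (V ω, W ω) with hP
  have key : ∑ ω, q (V ω) (W ω) * fiberCount V (V ω) / fiberCount P (P ω) ≤
      ∑ _ω : Ω, (1 : ℝ) := by
    have e1 : ∀ ω, q (V ω) (W ω) * fiberCount V (V ω) / fiberCount P (P ω) =
        ∑ ω₁, if V ω = V ω₁ then q (V ω₁) (W ω) / fiberCount P (V ω₁, W ω) else 0 := by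
      intro ω
      have : fiberCount V (V ω) = ∑ ω₁, if V ω = V ω₁ then (1 : ℝ) else 0 := by
        simp [fiberCount, eq_comm]
      rw [this, Finset.mul_sum, Finset.sum_div]
      refine Finset.sum_congr rfl fun ω₁ _ => ?_
      split_ifs with h <;> simp [hP, h]
    rw [Finset.sum_congr rfl fun ω _ => e1 ω, Finset.sum_comm]
    refine Finset.sum_le_sum fun ω₁ _ => le_trans ?_ (hsum ω₁)
    rw [← Finset.sum_fiberwise (s := Finset.univ) (g := W)]
    refine Finset.sum_le_sum fun w _ => ?_
    have e2 : ∑ ω with W ω = w,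
          (if V ω = V ω₁ then q (V ω₁) (W ω) / fiberCount P (V ω₁, W ω) else 0) =
        ∑ ω with P ω = (V ω₁, w), q (V ω₁) w / fiberCount P (V ω₁, w) := by
      rw [← Finset.sum_filter, Finset.filter_filter]
      refine Finset.sum_congr ?_ fun ω hω => ?_
      · ext ω
        simp [hP, and_comm]
      · simp only [hP, Finset.mem_filter, Prod.mk.injEq] at hω
        rw [hω.2.2]
    rw [e2, Finset.sum_const, nsmul_eq_mul]
    have hcard : (Finset.card {ω | P ω = (V ω₁, w)} : ℝ) = fiberCount P (V ω₁, w) := by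
      unfold fiberCount
      congr
    rw [hcard]
    rcases (fiberCount_nonneg P (V ω₁, w)).eq_or_lt with h | h
    · simp [← h, hq]
    · rw [mul_div_cancel₀ _ h.ne']
  have step : ∀ ω, Real.log (fiberCount V (V ω)) - Real.log (fiberCount P (P ω)) +
      Real.log (q (V ω) (W ω)) ≤
      q (V ω) (W ω) * fiberCount V (V ω) / fiberCount P (P ω) - 1 := by
    intro ω
    have hV := fiberCount_pos V ω
    have hPp := fiberCount_pos P ω
    have := Real.log_le_sub_one_of_pos (div_pos (mul_pos (hpos ω) hV) hPp)
    rw [Real.log_div (mul_pos (hpos ω) hV).ne' hPp.ne', Real.log_mul (hpos ω).ne' hV.ne'] at this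
    linarith
  have total := Finset.sum_le_sum fun ω (_ : ω ∈ Finset.univ) => step ω
  rw [Finset.sum_add_distrib, Finset.sum_sub_distrib, Finset.sum_sub_distrib] at total
  rw [Finset.sum_neg_distrib]
  unfold logFiber
  linarith

/-- Conditioning reduces entropy. -/
theorem logFiber_sub_pair_le_of_cond [Fintype β] (Z : Ω → α) (Y : Ω → γ) (X : Ω → β) :
    logFiber (fun ω => (Z ω, Y ω)) - logFiber (fun ω => ((Z ω, Y ω), X ω)) ≤
      logFiber Z - logFiber (fun ω => (Z ω, X ω)) := by
  refine (logFiber_sub_pair_le (fun ω => (Z ω, Y ω)) X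
    (fun v x => fiberCount (fun ω => (Z ω, X ω)) (v.1, x) / fiberCount Z v.1)
    (fun v x => div_nonneg (fiberCount_nonneg _ _) (fiberCount_nonneg _ _))
    (fun ω => div_pos (fiberCount_pos (fun ω => (Z ω, X ω)) ω) (fiberCount_pos Z ω))
    (fun ω => ?_)).trans_eq ?_
  · rw [← Finset.sum_div, sum_fiberCount_pair, div_self (fiberCount_pos Z ω).ne']
  · rw [logFiber, logFiber, ← Finset.sum_sub_distrib]
    refine Finset.sum_congr rfl fun ω _ => ?_
    have h1 := (fiberCount_pos (fun ω => (Z ω, X ω)) ω).ne'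
    have h2 := (fiberCount_pos Z ω).ne'
    dsimp only at h1 ⊢
    rw [Real.log_div h1 h2]
    ring

end LogFiber

/-! ### Entropy of erased words -/

/-- The output of an erasure channel with input `f ω` and set `S` of unerased positions. -/
def erasedWord {Ω ι P : Type*} [DecidableEq ι] (f : Ω → ι → P) (S : Finset ι) (ω : Ω) :
    ι → Option P :=
  fun t => if t ∈ S then some (f ω t) else none

/-- `|Ω|` times the conditional entropy, given `U`, of the letters of `f` at the positions in `S`,
under the uniform law on `Ω`. -/
noncomputable def erasedEntropy {Ω ι P α : Type*} [DecidableEq ι] [Fintype Ω] (U : Ω → α)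
    (f : Ω → ι → P) (S : Finset ι) : ℝ :=
  logFiber U - logFiber (fun ω => (U ω, erasedWord f S ω))

section ErasedEntropy

variable {Ω ι P α β : Type*} [DecidableEq ι]

theorem erasedWord_eq_iff (f : Ω → ι → P) (S : Finset ι) (ω ω' : Ω) :
    erasedWord f S ω' = erasedWord f S ω ↔ ∀ t ∈ S, f ω' t = f ω t := by
  rw [funext_iff]
  refine forall_congr' fun t => ?_
  by_cases h : t ∈ S <;> simp [erasedWord, h]

variable [Fintype Ω]

theorem erasedEntropy_nonneg (U : Ω → α) (f : Ω → ι → P) (S : Finset ι) :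
    0 ≤ erasedEntropy U f S :=
  sub_nonneg.2 (logFiber_pair_le U _)

theorem erasedEntropy_empty (U : Ω → α) (f : Ω → ι → P) : erasedEntropy U f ∅ = 0 := by
  refine sub_eq_zero.2 (logFiber_congr fun ω ω' => ?_)
  simp [erasedWord_eq_iff]

theorem erasedEntropy_insert_sub (U : Ω → α) (f : Ω → ι → P) (a : ι) (S : Finset ι) :
    erasedEntropy U f (insert a S) - erasedEntropy U f S =
      logFiber (fun ω => (U ω, erasedWord f S ω)) -
        logFiber (fun ω => ((U ω, erasedWord f S ω), f ω a)) := by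
  have h : logFiber (fun ω => (U ω, erasedWord f (insert a S) ω)) =
      logFiber (fun ω => ((U ω, erasedWord f S ω), f ω a)) := by
    refine logFiber_congr fun ω ω' => ?_
    simp only [Prod.mk.injEq, erasedWord_eq_iff, Finset.forall_mem_insert]
    tauto
  rw [erasedEntropy, erasedEntropy, h]
  ring

theorem erasedEntropy_insert_sub_antitone [Fintype P] (U : Ω → α) (f : Ω → ι → P) (a : ι) :
    Antitone fun S => erasedEntropy U f (insert a S) - erasedEntropy U f S := by
  intro S T hST
  simp only [erasedEntropy_insert_sub]
  have h := logFiber_sub_pair_le_of_cond (fun ω => (U ω, erasedWord f S ω)) (erasedWord f T)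
    (fun ω => f ω a)
  have hT : ∀ ω ω', ((U ω', erasedWord f S ω'), erasedWord f T ω') =
      ((U ω, erasedWord f S ω), erasedWord f T ω) ↔
      (U ω', erasedWord f T ω') = (U ω, erasedWord f T ω) := by
    intro ω ω'
    simp only [Prod.mk.injEq, erasedWord_eq_iff]
    exact ⟨fun h => ⟨h.1.1, h.2⟩, fun h => ⟨⟨h.1, fun t ht => h.2 t (hST ht)⟩, h.2⟩⟩
  rw [logFiber_congr hT] at h
  refine le_trans (le_of_eq ?_) h
  congr 1
  refine logFiber_congr fun ω ω' => ?_
  rw [Prod.mk.injEq _ (f ω' a), Prod.mk.injEq _ (f ω' a), hT]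

theorem erasedEntropy_insert_sub_le [Fintype P] [Nonempty P] (U : Ω → α) (f : Ω → ι → P) (a : ι)
    (S : Finset ι) :
    erasedEntropy U f (insert a S) - erasedEntropy U f S ≤
      Fintype.card Ω * Real.log (Fintype.card P) := by
  rw [erasedEntropy_insert_sub]
  have hP : (0 : ℝ) < Fintype.card P := Nat.cast_pos.2 Fintype.card_pos
  refine (logFiber_sub_pair_le _ (fun ω => f ω a) (fun _ _ => (Fintype.card P : ℝ)⁻¹)
    (fun _ _ => (inv_pos.2 hP).le) (fun _ => inv_pos.2 hP) (fun ω => ?_)).trans_eq ?_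
  · simp [hP.ne']
  · simp [Real.log_inv]

/-- Fano's inequality, linearised at error probability `θ`. -/
theorem logFiber_sub_pair_le_of_guess [Fintype β] [DecidableEq β] [Nonempty β]
    (V : Ω → α) (W : Ω → β) (g : α → β) {θ : ℝ} (hθ0 : 0 < θ) (hθ1 : θ < 1) :
    logFiber V - logFiber (fun ω => (V ω, W ω)) ≤
      Fintype.card Ω * -Real.log (1 - θ) +
        ∑ ω, (if g (V ω) ≠ W ω then 1 else 0) * Real.log (Fintype.card β / θ) := by
  have hβ : (1 : ℝ) ≤ Fintype.card β := Nat.one_le_cast.2 Fintype.card_pos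
  have hβ0 : (0 : ℝ) < Fintype.card β := by linarith
  have hpos : ∀ v w, 0 < (if g v = w then 1 - θ else θ / Fintype.card β) := by
    intro v w
    split_ifs
    · linarith
    · positivity
  refine (logFiber_sub_pair_le V W (fun v w => if g v = w then 1 - θ else θ / Fintype.card β)
    (fun v w => (hpos v w).le) (fun ω => hpos _ _) (fun ω => ?_)).trans ?_
  · calc ∑ w, (if g (V ω) = w then 1 - θ else θ / Fintype.card β)
        ≤ ∑ w, ((if g (V ω) = w then 1 - θ else 0) + θ / Fintype.card β) := by
          refine Finset.sum_le_sum fun w _ => ?_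
          have : 0 ≤ θ / Fintype.card β := by positivity
          split_ifs <;> linarith
      _ = 1 := by
          rw [Finset.sum_add_distrib]
          simp
          field_simp
          ring
  · have hlog : 0 ≤ -Real.log (1 - θ) := by
      rw [neg_nonneg]
      exact Real.log_nonpos (by linarith) (by linarith)
    rw [← nsmul_eq_mul, ← Finset.card_univ (α := Ω), ← Finset.sum_const, ← Finset.sum_add_distrib]
    refine Finset.sum_le_sum fun ω _ => ?_
    by_cases h : g (V ω) = W ω
    · simp [h]
    · simp only [h, if_false, ne_eq, not_false_eq_true, if_true, one_mul]
      rw [← Real.log_inv, inv_div]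
      linarith

end ErasedEntropy

/-! ### Converse -/

section Converse

variable {K : ℕ} {m : Fin K → ℕ}

/-- The messages with index less than `k`. -/
def messagePrefix (m : Fin K → ℕ) (k : ℕ) (w : ∀ i, Fin (m i)) :
    ∀ i : {i : Fin K // i.val < k}, Fin (m i) :=
  fun i => w i

theorem messagePrefix_eq_iff (k : ℕ) (w w' : ∀ i, Fin (m i)) :
    messagePrefix m k w' = messagePrefix m k w ↔ ∀ i : Fin K, i.val < k → w' i = w i := by
  simp [funext_iff, messagePrefix]

theorem messagePrefix_succ_eq_iff (k : Fin K) (w w' : ∀ i, Fin (m i)) :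
    messagePrefix m (k + 1) w' = messagePrefix m (k + 1) w ↔
      messagePrefix m k w' = messagePrefix m k w ∧ w' k = w k := by
  simp only [messagePrefix_eq_iff]
  refine ⟨fun h => ⟨fun i hi => h i (by omega), h k (by omega)⟩, fun h i hi => ?_⟩
  rcases Nat.lt_succ_iff_lt_or_eq.1 hi with hi | hi
  · exact h.1 i hi
  · rw [Fin.ext hi]
    exact h.2

theorem logFiber_messagePrefix (hm : ∀ i, 0 < m i) (k : ℕ) :
    logFiber (messagePrefix m k) =
      (∏ i, m i : ℕ) * ∑ i : Fin K, if i.val < k then 0 else Real.log (m i) := by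
  have h : ∀ w, fiberCount (messagePrefix m k) (messagePrefix m k w) =
      ∏ i : Fin K, if i.val < k then (1 : ℝ) else m i := by
    intro w
    have hset : fiberCount (messagePrefix m k) (messagePrefix m k w) = Finset.card
        (Fintype.piFinset fun i : Fin K => if i.val < k then {w i} else Finset.univ) := by
      unfold fiberCount
      congr 2
      ext w'
      simp only [Finset.mem_filter, Finset.mem_univ, true_and, messagePrefix_eq_iff,
        Fintype.mem_piFinset]
      refine forall_congr' fun i => ?_
      by_cases hi : i.val < k <;> simp [hi]
    rw [hset, Fintype.card_piFinset]
    push_cast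
    refine Finset.prod_congr rfl fun i _ => ?_
    by_cases hi : i.val < k <;> simp [hi]
  simp only [logFiber, h]
  rw [Finset.sum_const, nsmul_eq_mul, Finset.card_univ, Fintype.card_pi]
  simp only [Fintype.card_fin]
  rw [Real.log_prod]
  · congr 1
    refine Finset.sum_congr rfl fun i _ => ?_
    split_ifs <;> simp
  · intro i _
    split_ifs
    · exact one_ne_zero
    · exact Nat.cast_ne_zero.2 (hm i).ne'

theorem logFiber_messagePrefix_sub (hm : ∀ i, 0 < m i) (k : Fin K) :
    logFiber (messagePrefix m k) - logFiber (messagePrefix m (k + 1)) =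
      (∏ i, m i : ℕ) * Real.log (m k) := by
  rw [logFiber_messagePrefix hm, logFiber_messagePrefix hm, ← mul_sub, ← Finset.sum_sub_distrib]
  congr 1
  rw [Finset.sum_eq_single k]
  · simp
  · intro i _ hik
    have : i.val ≠ k.val := fun h => hik (Fin.ext h)
    by_cases hi : i.val < k.val
    · simp [hi, Nat.lt_succ_of_lt hi]
    · have : ¬ i.val < k.val + 1 := by omega
      simp [hi, this]
  · simp

theorem degErrProb_eq {F n : ℕ} (δ : Fin K → ℝ)
    (f : (∀ k : Fin K, Fin (m k)) → Fin n → Packet F)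
    (φ : Fin K → (Fin n → Option (Packet F)) → ∀ k : Fin K, Fin (m k)) (j k : Fin K)
    (hm : ∀ i, 0 < m i) :
    bernoulliMean Finset.univ (1 - δ j) (fun S => ∑ w, if φ j (erasedWord f S w) k ≠ w k
      then (1 : ℝ) else 0) = (∏ i, m i : ℕ) * degErrProb K F n δ m f φ j k := by
  have hN : ((∏ i, m i : ℕ) : ℝ) ≠ 0 :=
    Nat.cast_ne_zero.2 (Finset.prod_pos fun i _ => hm i).ne'
  have hinv : ∏ i : Fin K, (1 : ℝ) / (m i) = ((∏ i, m i : ℕ) : ℝ)⁻¹ := by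
    simp [Finset.prod_inv_distrib]
  unfold degErrProb
  rw [bernoulliMean_univ, Finset.sum_comm, Finset.mul_sum]
  refine Finset.sum_congr rfl fun e _ => ?_
  rw [Finset.mul_sum, Finset.mul_sum]
  refine Finset.sum_congr rfl fun w _ => ?_
  have hword : erasedWord f ({t | e t = false} : Finset (Fin n)) w =
      fun t => if e t then none else some (f w t) := by
    funext t
    by_cases h : e t <;> simp [erasedWord, h]
  rw [hword, hinv, sub_sub_cancel]
  field_simp

theorem log_card_message_le {F n : ℕ} {δ : Fin K → ℝ} (k : Fin K) (hδ0 : 0 ≤ δ k)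
    (hδ1 : δ k ≤ 1) (f : (∀ k : Fin K, Fin (m k)) → Fin n → Packet F)
    (φ : Fin K → (Fin n → Option (Packet F)) → ∀ k : Fin K, Fin (m k))
    (hm : ∀ i, 0 < m i) {ε : ℝ} (hε0 : 0 < ε) (hε1 : ε < 1)
    (herr : degErrProb K F n δ m f φ k k ≤ ε) :
    (∏ i, m i : ℕ) * ((1 - ε) * Real.log (m k) + Real.log (1 - ε) + ε * Real.log ε) ≤
      bernoulliMean Finset.univ (1 - δ k) (erasedEntropy (messagePrefix m k) f) -
        bernoulliMean Finset.univ (1 - δ k) (erasedEntropy (messagePrefix m (k + 1)) f) := by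
  have hN : (0 : ℝ) < ((∏ i, m i : ℕ) : ℝ) := Nat.cast_pos.2 (Finset.prod_pos fun i _ => hm i)
  have hmk : (1 : ℝ) ≤ m k := Nat.one_le_cast.2 (hm k)
  have : Nonempty (Fin (m k)) := ⟨⟨0, hm k⟩⟩
  have hS : ∀ S : Finset (Fin n), (∏ i, m i : ℕ) * Real.log (m k) ≤
      ((erasedEntropy (messagePrefix m k) f S - erasedEntropy (messagePrefix m (k + 1)) f S) +
      (∏ i, m i : ℕ) * -Real.log (1 - ε)) + Real.log (m k / ε) *
        ∑ w, if φ k (erasedWord f S w) k ≠ w k then (1 : ℝ) else 0 := by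
    intro S
    have hF := logFiber_sub_pair_le_of_guess
      (fun w => (messagePrefix m k w, erasedWord f S w)) (fun w => w k) (fun v => φ k v.2 k)
      hε0 hε1
    rw [← Finset.sum_mul, Fintype.card_pi] at hF
    simp only [Fintype.card_fin] at hF
    have hU := logFiber_messagePrefix_sub hm k
    have hc : logFiber (fun w => ((messagePrefix m k w, erasedWord f S w), w k)) =
        logFiber (fun w => (messagePrefix m (k + 1) w, erasedWord f S w)) := by
      refine logFiber_congr fun w w' => ?_
      simp only [Prod.mk.injEq, messagePrefix_succ_eq_iff]
      tauto
    rw [hc] at hF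
    unfold erasedEntropy
    rw [mul_comm (Real.log _) (∑ w, _)]
    linarith
  have hmean := bernoulliMean_mono Finset.univ (sub_nonneg.2 hδ1) (sub_le_self 1 hδ0) hS
  rw [bernoulliMean_const, bernoulliMean_add, bernoulliMean_add, bernoulliMean_const,
    bernoulliMean_sub, bernoulliMean_const_mul, degErrProb_eq δ f φ k k hm] at hmean
  have hlog : 0 ≤ Real.log (m k / ε) := Real.log_nonneg (by rw [le_div_iff₀ hε0]; linarith)
  have h1 := mul_le_mul_of_nonneg_left (mul_le_mul_of_nonneg_left herr hN.le) hlog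
  rw [Real.log_div (by linarith) hε0.ne'] at h1 hmean
  linarith

theorem sum_div_le_of_telescoping (p : Fin K → ℝ) (hp0 : ∀ k, 0 < p k) (hp1 : ∀ k, p k ≤ 1)
    (hp : Monotone p) (g : ℕ → ℝ → ℝ) {B : ℝ} (hB : ∀ k, g 0 (p k) ≤ p k * B) (hB0 : 0 ≤ B)
    (hg0 : ∀ k x, 0 ≤ x → x ≤ 1 → 0 ≤ g k x)
    (hg : ∀ k x y, 0 ≤ x → x ≤ y → y ≤ 1 → x * g k y ≤ y * g k x) :
    ∑ k : Fin K, (g k (p k) - g (k + 1) (p k)) / p k ≤ B := by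
  set P : ℕ → ℝ := fun i => if h : i < K then p ⟨i, h⟩ else 1 with hP
  have hPpos : ∀ i, 0 < P i := by
    intro i
    simp only [hP]
    split_ifs
    · exact hp0 _
    · exact one_pos
  have hP1 : ∀ i, P i ≤ 1 := by
    intro i
    simp only [hP]
    split_ifs
    · exact hp1 _
    · exact le_rfl
  have hPsucc : ∀ i, P i ≤ P (i + 1) := by
    intro i
    by_cases h : i + 1 < K
    · have h' : i < K := by omega
      simp only [hP, h, h', dif_pos]
      exact hp (Fin.mk_le_mk.2 (Nat.le_succ i))
    · rw [show P (i + 1) = 1 by simp [hP, h]]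
      exact hP1 i
  have hterm : ∀ i, (g i (P i) - g (i + 1) (P i)) / P i ≤
      g i (P i) / P i - g (i + 1) (P (i + 1)) / P (i + 1) := by
    intro i
    rw [sub_div]
    refine sub_le_sub_left ?_ _
    rw [div_le_div_iff₀ (hPpos _) (hPpos _)]
    have := hg (i + 1) (P i) (P (i + 1)) (hPpos i).le (hPsucc i) (hP1 _)
    linarith
  have hsum : ∑ k : Fin K, (g k (p k) - g (k + 1) (p k)) / p k =
      ∑ i ∈ Finset.range K, (g i (P i) - g (i + 1) (P i)) / P i := by
    rw [Finset.sum_range]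
    refine Finset.sum_congr rfl fun k _ => ?_
    simp [hP]
  rw [hsum]
  refine (Finset.sum_le_sum fun i _ => hterm i).trans ?_
  rw [Finset.sum_range_sub']
  have h1 : 0 ≤ g K (P K) / P K := div_nonneg (hg0 K _ (hPpos K).le (hP1 K)) (hPpos K).le
  rcases Nat.eq_zero_or_pos K with h | h
  · subst h
    simpa using hB0
  · have h2 : g 0 (P 0) / P 0 ≤ B := by
      rw [div_le_iff₀ (hPpos 0), mul_comm]
      simpa [hP, h] using hB ⟨0, h⟩
    linarith

/-- The weighted sum-rate bound satisfied by every code with small error probabilities. -/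
theorem sum_log_card_message_le {F n : ℕ} {δ : Fin K → ℝ} (hδ0 : ∀ k, 0 ≤ δ k)
    (hδ1 : ∀ k, δ k < 1) (hδ : Antitone δ) (f : (∀ k : Fin K, Fin (m k)) → Fin n → Packet F)
    (φ : Fin K → (Fin n → Option (Packet F)) → ∀ k : Fin K, Fin (m k))
    (hm : ∀ i, 0 < m i) {ε : ℝ} (hε0 : 0 < ε) (hε1 : ε < 1)
    (herr : ∀ k, degErrProb K F n δ m f φ k k ≤ ε) :
    ∑ k, ((1 - ε) * Real.log (m k) + Real.log (1 - ε) + ε * Real.log ε) / (1 - δ k) ≤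
      n * (F * Real.log 2) := by
  have hN : (0 : ℝ) < ((∏ i, m i : ℕ) : ℝ) := Nat.cast_pos.2 (Finset.prod_pos fun i _ => hm i)
  have hcard : Fintype.card (∀ i, Fin (m i)) = ∏ i, m i := by simp
  have key := sum_div_le_of_telescoping (fun k => 1 - δ k) (fun k => sub_pos.2 (hδ1 k))
    (fun k => sub_le_self 1 (hδ0 k)) (fun i j hij => sub_le_sub_left (hδ hij) 1)
    (fun i x => bernoulliMean Finset.univ x (erasedEntropy (messagePrefix m i) f))
    (B := n * ((∏ i, m i : ℕ) * (F * Real.log 2))) ?_ ?_ ?_ ?_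
  · rw [← mul_le_mul_iff_right₀ hN, Finset.mul_sum]
    refine (Finset.sum_le_sum fun k _ => ?_).trans (key.trans_eq (by ring))
    rw [← mul_div_assoc]
    exact div_le_div_of_nonneg_right (log_card_message_le k (hδ0 k) (hδ1 k).le f φ hm hε0 hε1
      (herr k)) (sub_pos.2 (hδ1 k)).le
  · intro k
    have h := bernoulliMean_le_card (p := 1 - δ k) Finset.univ (sub_pos.2 (hδ1 k)).le
      (sub_le_self 1 (hδ0 k))
      (erasedEntropy_empty (messagePrefix m 0) f).le (erasedEntropy_insert_sub_le _ f)
    rw [hcard] at h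
    simpa using h
  · have := Real.log_nonneg one_le_two
    positivity
  · intro i x hx0 hx1
    have h := bernoulliMean_mono Finset.univ hx0 hx1 (erasedEntropy_nonneg (messagePrefix m i) f)
    rwa [bernoulliMean_const] at h
  · intro i x y hx hxy hy
    exact mul_bernoulliMean_le _ hx hxy hy (erasedEntropy_nonneg _ f ∅)
      (erasedEntropy_insert_sub_antitone _ f)

theorem sum_rate_le_of_degAchievable {F : ℕ} (hF : 0 < F) {δ : Fin K → ℝ} (hδ0 : ∀ k, 0 ≤ δ k)
    (hδ1 : ∀ k, δ k < 1) (hδ : Antitone δ) {R : Fin K → ℝ} (h : DegAchievable K F δ R) :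
    ∑ k, R k / ((F : ℝ) * (1 - δ k)) ≤ 1 := by
  have hlog2 : 0 < Real.log 2 := Real.log_pos one_lt_two
  have hbound : ∀ ε ∈ Set.Ioo (0 : ℝ) 1,
      ∑ k, ((1 - ε) * ((R k - ε) * Real.log 2) + Real.log (1 - ε) + ε * Real.log ε) / (1 - δ k) ≤
        F * Real.log 2 := by
    rintro ε ⟨hε0, hε1⟩
    obtain ⟨n, hn, m, f, φ, hm, herr⟩ := h ε hε0
    have hn1 : (1 : ℝ) ≤ n := Nat.one_le_cast.2 hn
    have hmpos : ∀ k, 0 < m k := fun k =>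
      Nat.cast_pos.1 ((Real.rpow_pos_of_pos two_pos _).trans_le (hm k))
    have hs := sum_log_card_message_le hδ0 hδ1 hδ f φ hmpos hε0 hε1 fun k => herr k k le_rfl
    rw [← mul_le_mul_iff_right₀ (zero_lt_one.trans_le hn1), Finset.mul_sum]
    refine le_trans (Finset.sum_le_sum fun k _ => ?_) hs
    rw [← mul_div_assoc]
    refine div_le_div_of_nonneg_right ?_ (sub_pos.2 (hδ1 k)).le
    have hl := Real.log_le_log (Real.rpow_pos_of_pos two_pos _) (hm k)
    rw [Real.log_rpow two_pos] at hl
    have h1 := mul_le_mul_of_nonneg_left hl (sub_nonneg.2 hε1.le)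
    have h2 : Real.log (1 - ε) ≤ 0 := Real.log_nonpos (by linarith) (by linarith)
    have h3 : ε * Real.log ε ≤ 0 :=
      mul_nonpos_of_nonneg_of_nonpos hε0.le (Real.log_nonpos hε0.le hε1.le)
    nlinarith [mul_nonneg (sub_nonneg.2 hn1) (neg_nonneg.2 h2),
      mul_nonneg (sub_nonneg.2 hn1) (neg_nonneg.2 h3)]
  have hcont : ContinuousAt (fun ε : ℝ => ∑ k, ((1 - ε) * ((R k - ε) * Real.log 2) +
      Real.log (1 - ε) + ε * Real.log ε) / (1 - δ k)) 0 := by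
    have h1 : ContinuousAt (fun ε : ℝ => Real.log (1 - ε)) 0 :=
      ContinuousAt.log (by fun_prop) (by norm_num)
    have h2 : ContinuousAt (fun ε : ℝ => ε * Real.log ε) 0 := Real.continuous_mul_log.continuousAt
    fun_prop
  have hlim := hcont.tendsto.mono_left (nhdsWithin_le_nhds (s := Set.Ioi 0))
  have hle := le_of_tendsto hlim (Filter.eventually_of_mem (Ioo_mem_nhdsGT one_pos) hbound)
  have hFl : (0 : ℝ) < F * Real.log 2 := mul_pos (Nat.cast_pos.2 hF) hlog2
  rw [← mul_le_mul_iff_right₀ hFl, mul_one, Finset.mul_sum]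
  refine le_trans (le_of_eq (Finset.sum_congr rfl fun k _ => ?_)) hle
  have h1 := (sub_pos.2 (hδ1 k)).ne'
  have h2 : (F : ℝ) ≠ 0 := Nat.cast_ne_zero.2 hF.ne'
  simp
  field_simp

end Converse

/-! ### Achievability -/

section Achievability

theorem sum_collision {I P : Type*} [Fintype I] [DecidableEq I] [Fintype P] [DecidableEq P]
    [Nonempty P] {a b : I} (hab : a ≠ b) :
    ∑ g : I → P, (if g a = g b then (1 : ℝ) else 0) =
      Fintype.card (I → P) * (Fintype.card P : ℝ)⁻¹ := by
  have hP : (Fintype.card P : ℝ) ≠ 0 := Nat.cast_ne_zero.2 Fintype.card_ne_zero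
  rw [← (Equiv.funSplitAt b P).symm.sum_comp, Fintype.sum_prod_type, Finset.sum_comm,
    Fintype.card_congr (Equiv.funSplitAt b P), Fintype.card_prod]
  simp [Equiv.funSplitAt, Equiv.piSplitAt, hab]
  field_simp

theorem sum_prod_apply {ι X : Type*} [Fintype ι] [DecidableEq ι] [Fintype X] (f : ι → X → ℝ) :
    ∑ x : ι → X, ∏ i, f i (x i) = ∏ i, ∑ y, f i y := by
  rw [Finset.prod_univ_sum, Fintype.piFinset_univ]

theorem sum_prod_collision {ι I P : Type*} [Fintype ι] [DecidableEq ι] [Fintype I] [DecidableEq I]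
    [Fintype P] [DecidableEq P] [Nonempty P] {a b : I} (hab : a ≠ b) (T : ι → Prop)
    [DecidablePred T] :
    ∑ c : ι → I → P, ∏ t, (if T t → c t a = c t b then (1 : ℝ) else 0) =
      Fintype.card (ι → I → P) * ∏ t, if T t then (Fintype.card P : ℝ)⁻¹ else 1 := by
  have hcard : (Fintype.card (ι → I → P) : ℝ) = ∏ _t : ι, (Fintype.card (I → P) : ℝ) := by
    rw [Fintype.card_fun]
    simp
  rw [sum_prod_apply (fun t (g : I → P) => if T t → g a = g b then (1 : ℝ) else 0), hcard,
    ← Finset.prod_mul_distrib]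
  refine Finset.prod_congr rfl fun t _ => ?_
  by_cases h : T t
  · simpa only [h, forall_true_left, if_true] using sum_collision hab
  · simp [h]

theorem min_one_le_rpow {x s : ℝ} (hx : 0 < x) (hs0 : 0 ≤ s) (hs1 : s ≤ 1) :
    min 1 x ≤ x ^ s := by
  rcases le_total x 1 with h | h
  · calc min 1 x ≤ x := min_le_right _ _
      _ = x ^ (1 : ℝ) := (Real.rpow_one x).symm
      _ ≤ x ^ s := Real.rpow_le_rpow_of_exponent_ge hx h hs1
  · exact (min_le_left _ _).trans (Real.one_le_rpow h hs0)

variable {K F n : ℕ} {m : Fin K → ℕ}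

/-- A codebook assigns to each channel use a packet for each value of each message. -/
abbrev Codebook (F n : ℕ) (m : Fin K → ℕ) := Fin n → (Σ k, Fin (m k)) → Packet F

/-- Time sharing: at time `t`, transmit the codeword letter of message `b t`. -/
def encode (b : Fin n → Fin K) (c : Codebook F n m) (w : ∀ k, Fin (m k)) (t : Fin n) : Packet F :=
  c t ⟨b t, w (b t)⟩

/-- The received word `y` is compatible with the value `v` of message `k`. -/
def Compatible (b : Fin n → Fin K) (c : Codebook F n m) (y : Fin n → Option (Packet F))
    (k : Fin K) (v : Fin (m k)) : Prop :=
  ∀ t, b t = k → ∀ x, y t = some x → x = c t ⟨k, v⟩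

/-- Decode each message to some compatible value. -/
noncomputable def decode [∀ k, NeZero (m k)] (b : Fin n → Fin K) (c : Codebook F n m)
    (y : Fin n → Option (Packet F)) (k : Fin K) : Fin (m k) :=
  if h : ∃ v, Compatible b c y k v then h.choose else 0

theorem exists_collision_of_decode_ne [∀ k, NeZero (m k)] {b : Fin n → Fin K}
    {c : Codebook F n m} {e : Fin n → Bool} {w : ∀ k, Fin (m k)} {k : Fin K}
    (h : decode b c (fun t => if e t then none else some (encode b c w t)) k ≠ w k) :
    ∃ v, v ≠ w k ∧ ∀ t, b t = k ∧ e t = false → c t ⟨k, v⟩ = c t ⟨k, w k⟩ := by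
  set y : Fin n → Option (Packet F) := fun t => if e t then none else some (encode b c w t)
  have hy : ∀ t, b t = k → e t = false → y t = some (c t ⟨k, w k⟩) := by
    rintro t rfl he
    simp [y, he, encode]
  have hex : ∃ v, Compatible b c y k v := by
    refine ⟨w k, fun t ht x hx => ?_⟩
    cases he : e t
    · rw [hy t ht he] at hx
      exact (Option.some.inj hx).symm
    · simp [y, he] at hx
  refine ⟨decode b c y k, h, fun t ht => ?_⟩
  have hspec : Compatible b c y k (decode b c y k) := by
    rw [decode, dif_pos hex]
    exact hex.choose_spec
  exact (hspec t ht.1 _ (hy t ht.1 ht.2)).symm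

theorem sum_decode_ne_le [∀ k, NeZero (m k)] (b : Fin n → Fin K) (e : Fin n → Bool)
    (w : ∀ k, Fin (m k)) (k : Fin K) {s : ℝ} (hs0 : 0 ≤ s) (hs1 : s ≤ 1) :
    ∑ c : Codebook F n m, (if decode b c
        (fun t => if e t then none else some (encode b c w t)) k ≠ w k then (1 : ℝ) else 0) ≤
      Fintype.card (Codebook F n m) * ((m k : ℝ) ^ s *
        ∏ t, if b t = k ∧ e t = false then ((2 : ℝ) ^ F) ^ (-s) else 1) := by
  set x : ℝ := m k * ∏ t, if b t = k ∧ e t = false then ((2 : ℝ) ^ F)⁻¹ else 1 with hx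
  have hm : (0 : ℝ) < m k := Nat.cast_pos.2 (NeZero.pos (m k))
  have hfac : ∀ t, 0 < (if b t = k ∧ e t = false then ((2 : ℝ) ^ F)⁻¹ else 1) := by
    intro t
    split_ifs <;> positivity
  have hx0 : 0 < x := mul_pos hm (Finset.prod_pos fun t _ => hfac t)
  have hxs : x ^ s = (m k : ℝ) ^ s *
      ∏ t, if b t = k ∧ e t = false then ((2 : ℝ) ^ F) ^ (-s) else 1 := by
    rw [hx, Real.mul_rpow hm.le (Finset.prod_nonneg fun t _ => (hfac t).le),
      ← Real.finsetProd_rpow _ _ fun t _ => (hfac t).le]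
    congr 1
    refine Finset.prod_congr rfl fun t _ => ?_
    split_ifs
    · rw [Real.inv_rpow (by positivity), Real.rpow_neg (by positivity)]
    · exact Real.one_rpow s
  rw [← hxs]
  refine le_trans ?_ (mul_le_mul_of_nonneg_left (min_one_le_rpow hx0 hs0 hs1) (Nat.cast_nonneg _))
  rw [mul_min_of_nonneg _ _ (Nat.cast_nonneg _)]
  refine le_min ?_ ?_
  · refine (Finset.sum_le_sum fun c _ => (?_ : _ ≤ (1 : ℝ))).trans_eq (by simp)
    split_ifs <;> norm_num
  · have hcol : ∀ v : Fin (m k), v ≠ w k →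
        ∑ c : Codebook F n m, ∏ t, (if b t = k ∧ e t = false → c t ⟨k, v⟩ = c t ⟨k, w k⟩
          then (1 : ℝ) else 0) =
        Fintype.card (Codebook F n m) *
          ∏ t, if b t = k ∧ e t = false then ((2 : ℝ) ^ F)⁻¹ else 1 := by
      intro v hv
      have hne : (⟨k, v⟩ : Σ k, Fin (m k)) ≠ ⟨k, w k⟩ := by
        intro h
        exact hv (eq_of_heq (Sigma.mk.inj h).2)
      rw [sum_prod_collision hne fun t => b t = k ∧ e t = false]
      simp
    have hnn : ∀ (c : Codebook F n m) (v : Fin (m k)), (0 : ℝ) ≤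
        ∏ t, (if b t = k ∧ e t = false → c t ⟨k, v⟩ = c t ⟨k, w k⟩ then (1 : ℝ) else 0) :=
      fun c v => Finset.prod_nonneg fun t _ => by split_ifs <;> norm_num
    calc _ ≤ ∑ c : Codebook F n m, ∑ v ∈ {v | v ≠ w k}, ∏ t,
          (if b t = k ∧ e t = false → c t ⟨k, v⟩ = c t ⟨k, w k⟩ then (1 : ℝ) else 0) := by
          refine Finset.sum_le_sum fun c _ => ?_
          split_ifs with h
          · obtain ⟨v, hv, hc⟩ := exists_collision_of_decode_ne h
            refine le_trans ?_ (Finset.single_le_sum (fun v _ => hnn c v)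
              (show v ∈ ({v | v ≠ w k} : Finset (Fin (m k))) by simpa using hv))
            rw [Finset.prod_congr rfl fun t _ => if_pos (hc t)]
            simp
          · exact Finset.sum_nonneg fun v _ => hnn c v
      _ = ∑ v ∈ ({v | v ≠ w k} : Finset (Fin (m k))), (Fintype.card (Codebook F n m) : ℝ) *
          ∏ t, (if b t = k ∧ e t = false then ((2 : ℝ) ^ F)⁻¹ else 1) := by
          rw [Finset.sum_comm]
          exact Finset.sum_congr rfl fun v hv => hcol v (Finset.mem_filter.1 hv).2
      _ ≤ Fintype.card (Codebook F n m) * x := by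
          rw [Finset.sum_const, nsmul_eq_mul, hx, mul_left_comm]
          refine mul_le_mul_of_nonneg_left ?_ (Nat.cast_nonneg _)
          refine mul_le_mul_of_nonneg_right (Nat.cast_le.2 ?_)
            (Finset.prod_nonneg fun t _ => (hfac t).le)
          exact (Finset.card_le_univ _).trans_eq (Fintype.card_fin _)

/-- The error probability of the random code, averaged over all codebooks. -/
theorem sum_degErrProb_le [∀ k, NeZero (m k)] (b : Fin n → Fin K) {δ : Fin K → ℝ} (j k : Fin K)
    (hδ0 : 0 ≤ δ j) (hδ1 : δ j ≤ 1) {s : ℝ} (hs0 : 0 ≤ s) (hs1 : s ≤ 1) :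
    ∑ c : Codebook F n m, degErrProb K F n δ m (encode b c) (fun _ => decode b c) j k ≤
      Fintype.card (Codebook F n m) * ((m k : ℝ) ^ s *
        (1 - (1 - δ j) * (1 - ((2 : ℝ) ^ F) ^ (-s))) ^ Finset.card {t | b t = k}) := by
  have hw : ∑ _w : ∀ i, Fin (m i), ∏ i : Fin K, (1 : ℝ) / (m i) = 1 := by
    have h : ∀ i, (m i : ℝ) ≠ 0 := fun i => Nat.cast_ne_zero.2 (NeZero.ne (m i))
    rw [Finset.sum_const, Finset.card_univ, Fintype.card_pi, nsmul_eq_mul]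
    push_cast
    rw [← Finset.prod_mul_distrib]
    exact Finset.prod_eq_one fun i _ => by simp [h]
  have he : ∑ e : Fin n → Bool, (∏ t, if e t then δ j else 1 - δ j) *
      ∏ t, (if b t = k ∧ e t = false then ((2 : ℝ) ^ F) ^ (-s) else 1) =
      (1 - (1 - δ j) * (1 - ((2 : ℝ) ^ F) ^ (-s))) ^ Finset.card {t | b t = k} := by
    simp only [← Finset.prod_mul_distrib]
    rw [sum_prod_apply fun t (x : Bool) => (if x then δ j else 1 - δ j) *
      (if b t = k ∧ x = false then ((2 : ℝ) ^ F) ^ (-s) else 1), ← Finset.prod_const,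
      Finset.prod_filter]
    refine Finset.prod_congr rfl fun t _ => ?_
    by_cases h : b t = k
    · simp [h]
      ring
    · simp [h]
  unfold degErrProb
  rw [Finset.sum_comm]
  calc _ ≤ ∑ _w : ∀ i, Fin (m i), ∑ e : Fin n → Bool, ((∏ i : Fin K, (1 : ℝ) / (m i)) *
        ∏ t : Fin n, (if e t then δ j else 1 - δ j)) * (Fintype.card (Codebook F n m) *
        ((m k : ℝ) ^ s * ∏ t, if b t = k ∧ e t = false then ((2 : ℝ) ^ F) ^ (-s) else 1)) := by
        refine Finset.sum_le_sum fun w _ => ?_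
        rw [Finset.sum_comm]
        refine Finset.sum_le_sum fun e _ => ?_
        rw [← Finset.mul_sum]
        refine mul_le_mul_of_nonneg_left (sum_decode_ne_le b e w k hs0 hs1) ?_
        refine mul_nonneg (Finset.prod_nonneg fun i _ => by positivity)
          (Finset.prod_nonneg fun t _ => ?_)
        split_ifs <;> linarith
    _ = (∑ _w : ∀ i, Fin (m i), ∏ i : Fin K, (1 : ℝ) / (m i)) *
        (Fintype.card (Codebook F n m) * ((m k : ℝ) ^ s *
        ∑ e : Fin n → Bool, (∏ t, if e t then δ j else 1 - δ j) *
        ∏ t, (if b t = k ∧ e t = false then ((2 : ℝ) ^ F) ^ (-s) else 1))) := by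
        rw [Finset.sum_mul]
        refine Finset.sum_congr rfl fun w _ => ?_
        simp only [Finset.mul_sum]
        exact Finset.sum_congr rfl fun e _ => by ring
    _ = _ := by rw [hw, he, one_mul]

theorem degErrProb_nonneg {δ : Fin K → ℝ} (f : (∀ k : Fin K, Fin (m k)) → Fin n → Packet F)
    (φ : Fin K → (Fin n → Option (Packet F)) → ∀ k : Fin K, Fin (m k)) (j k : Fin K)
    (hδ0 : 0 ≤ δ j) (hδ1 : δ j ≤ 1) : 0 ≤ degErrProb K F n δ m f φ j k := by
  refine Finset.sum_nonneg fun w _ => Finset.sum_nonneg fun e _ => mul_nonneg (mul_nonneg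
    (Finset.prod_nonneg fun i _ => by positivity) (Finset.prod_nonneg fun t _ => ?_)) ?_
  · split_ifs <;> linarith
  · split_ifs <;> norm_num

theorem exists_codebook [∀ k, NeZero (m k)] (b : Fin n → Fin K) {δ : Fin K → ℝ}
    (hδ0 : ∀ k, 0 ≤ δ k) (hδ1 : ∀ k, δ k ≤ 1) (hδ : Antitone δ) {s : Fin K → ℝ}
    (hs0 : ∀ k, 0 ≤ s k) (hs1 : ∀ k, s k ≤ 1) :
    ∃ c : Codebook F n m, ∀ j k, k ≤ j →
      degErrProb K F n δ m (encode b c) (fun _ => decode b c) j k ≤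
      K * ∑ k, (m k : ℝ) ^ s k *
        (1 - (1 - δ k) * (1 - ((2 : ℝ) ^ F) ^ (-s k))) ^ Finset.card {t | b t = k} := by
  set B : Fin K → ℝ := fun k => (m k : ℝ) ^ s k *
    (1 - (1 - δ k) * (1 - ((2 : ℝ) ^ F) ^ (-s k))) ^ Finset.card {t | b t = k} with hB
  have hq0 : ∀ k, 0 ≤ ((2 : ℝ) ^ F) ^ (-s k) := fun k => by positivity
  have hq1 : ∀ k, ((2 : ℝ) ^ F) ^ (-s k) ≤ 1 := fun k =>
    Real.rpow_le_one_of_one_le_of_nonpos (one_le_pow₀ one_le_two) (neg_nonpos.2 (hs0 k))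
  have hbase : ∀ j k, 0 ≤ 1 - (1 - δ j) * (1 - ((2 : ℝ) ^ F) ^ (-s k)) := fun j k => by
    nlinarith [hδ0 j, hδ1 j, hq0 k, hq1 k, mul_nonneg (hδ0 j) (sub_nonneg.2 (hq1 k))]
  have hB0 : ∀ k, 0 ≤ B k := fun k => mul_nonneg (by positivity) (pow_nonneg (hbase k k) _)
  have hsum : ∀ j k, k ≤ j →
      ∑ c : Codebook F n m, degErrProb K F n δ m (encode b c) (fun _ => decode b c) j k ≤
        Fintype.card (Codebook F n m) * B k := by
    intro j k hkj
    refine (sum_degErrProb_le b j k (hδ0 j) (hδ1 j) (hs0 k) (hs1 k)).trans ?_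
    refine mul_le_mul_of_nonneg_left (mul_le_mul_of_nonneg_left ?_ (by positivity))
      (Nat.cast_nonneg _)
    refine pow_le_pow_left₀ (hbase j k) ?_ _
    nlinarith [hδ hkj, mul_nonneg (sub_nonneg.2 (hδ hkj)) (sub_nonneg.2 (hq1 k))]
  set D : Codebook F n m → Fin K → Fin K → ℝ := fun c j k =>
    if k ≤ j then degErrProb K F n δ m (encode b c) (fun _ => decode b c) j k else 0 with hD
  have hD0 : ∀ c j k, 0 ≤ D c j k := by
    intro c j k
    simp only [hD]
    split_ifs
    · exact degErrProb_nonneg _ _ j k (hδ0 j) (hδ1 j)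
    · exact le_rfl
  have htotal : ∑ c, ∑ j, ∑ k, D c j k ≤ ∑ _c : Codebook F n m, K * ∑ k, B k := by
    calc ∑ c, ∑ j, ∑ k, D c j k = ∑ j, ∑ k, ∑ c, D c j k := by
          rw [Finset.sum_comm]
          exact Finset.sum_congr rfl fun j _ => Finset.sum_comm
      _ ≤ ∑ _j : Fin K, ∑ k, Fintype.card (Codebook F n m) * B k := by
          refine Finset.sum_le_sum fun j _ => Finset.sum_le_sum fun k _ => ?_
          by_cases h : k ≤ j
          · simpa only [hD, h, if_true] using hsum j k h
          · simp only [hD, h, if_false, Finset.sum_const_zero]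
            exact mul_nonneg (Nat.cast_nonneg _) (hB0 k)
      _ = ∑ _c : Codebook F n m, K * ∑ k, B k := by
          simp only [Finset.sum_const, Finset.card_univ, nsmul_eq_mul, Fintype.card_fin,
            ← Finset.mul_sum]
          ring
  obtain ⟨c, -, hc⟩ := Finset.exists_le_of_sum_le Finset.univ_nonempty htotal
  refine ⟨c, fun j k hkj => le_trans ?_ hc⟩
  calc _ = D c j k := by simp [hD, hkj]
    _ ≤ ∑ k, D c j k := Finset.single_le_sum (fun k _ => hD0 c j k) (Finset.mem_univ k)
    _ ≤ ∑ j, ∑ k, D c j k := Finset.single_le_sum (f := fun j => ∑ k, D c j k)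
        (fun j _ => Finset.sum_nonneg fun k _ => hD0 c j k) (Finset.mem_univ j)

theorem exists_fiber_card_ge {κ τ : Type*} [Fintype κ] [DecidableEq κ] [Nonempty κ] [Fintype τ]
    (N : κ → ℕ) (h : ∑ k, N k ≤ Fintype.card τ) :
    ∃ b : τ → κ, ∀ k, N k ≤ Finset.card {t | b t = k} := by
  have hcard : Fintype.card (Σ k, Fin (N k)) ≤ Fintype.card τ := by simpa using h
  obtain ⟨g⟩ := Function.Embedding.nonempty_of_card_le hcard
  obtain ⟨k₀⟩ := ‹Nonempty κ›
  refine ⟨Function.extend g Sigma.fst fun _ => k₀, fun k => ?_⟩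
  have himg : Finset.card (Finset.univ.image fun i : Fin (N k) => g ⟨k, i⟩) = N k := by
    rw [Finset.card_image_of_injective, Finset.card_univ, Fintype.card_fin]
    intro i i' hi
    simpa using g.injective hi
  rw [← himg]
  refine Finset.card_le_card fun t ht => ?_
  obtain ⟨i, -, rfl⟩ := Finset.mem_image.1 ht
  simp [g.injective.extend_apply]

/-- Below capacity, some exponent makes the union bound decay. -/
theorem exists_decay_exponent (hF : 0 < F) {p α r : ℝ} (hp0 : 0 < p) (hp1 : p ≤ 1) (hr0 : 0 ≤ r)
    (hr : r < F * p * α) :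
    ∃ s : ℝ, 0 < s ∧ s ≤ 1 ∧ 0 < 1 - p * (1 - ((2 : ℝ) ^ F) ^ (-s)) ∧
      1 - p * (1 - ((2 : ℝ) ^ F) ^ (-s)) ≤ 1 ∧
      2 ^ (s * r) * (1 - p * (1 - ((2 : ℝ) ^ F) ^ (-s))) ^ α < 1 := by
  have hF0 : (0 : ℝ) < F := Nat.cast_pos.2 hF
  have hlog2 : 0 < Real.log 2 := Real.log_pos one_lt_two
  have hα : 0 < α := by
    by_contra! h
    nlinarith [mul_pos hF0 hp0]
  obtain ⟨s, hs, hs0, hs1⟩ : ∃ s : ℝ, r * (1 + s * (F * Real.log 2)) < F * p * α ∧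
      0 < s ∧ s ≤ 1 := by
    have hc : ContinuousAt (fun s : ℝ => r * (1 + s * (F * Real.log 2))) 0 := by fun_prop
    have h1 := (hc.tendsto.eventually_lt_const (u := F * p * α) (by simpa using hr)).filter_mono
      (nhdsWithin_le_nhds (s := Set.Ioi 0))
    exact (h1.and (Ioc_mem_nhdsGT one_pos)).exists
  set x := s * (F * Real.log 2) with hx
  have hx0 : 0 < x := by positivity
  have hq : ((2 : ℝ) ^ F) ^ (-s) = Real.exp (-x) := by
    rw [Real.rpow_def_of_pos (by positivity), Real.log_pow]
    congr 1
    rw [hx]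
    ring
  have hexp : Real.exp (-x) ≤ 1 / (1 + x) := by
    rw [Real.exp_neg, ← one_div]
    exact one_div_le_one_div_of_le (by positivity) (by linarith [Real.add_one_le_exp x])
  have hexp0 := Real.exp_pos (-x)
  have hexp1 : Real.exp (-x) ≤ 1 := Real.exp_le_one_iff.2 (by linarith)
  have hbase : 0 < 1 - p * (1 - Real.exp (-x)) := by nlinarith [mul_pos hp0 hexp0]
  refine ⟨s, hs0, hs1, ?_, ?_, ?_⟩
  · rwa [hq]
  · rw [hq]
    nlinarith
  · rw [hq, Real.rpow_def_of_pos two_pos, Real.rpow_def_of_pos hbase, ← Real.exp_add,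
      Real.exp_lt_one_iff]
    have h1 := Real.log_le_sub_one_of_pos hbase
    have h2 : x / (1 + x) ≤ 1 - Real.exp (-x) := by
      have : x / (1 + x) = 1 - 1 / (1 + x) := by field_simp; ring
      linarith
    have h3 : Real.log (1 - p * (1 - Real.exp (-x))) ≤ -(p * (x / (1 + x))) := by
      nlinarith
    have h4 := mul_le_mul_of_nonneg_right h3 hα.le
    have h5 : Real.log 2 * (s * r) < p * (x / (1 + x)) * α := by
      rw [← mul_div_assoc, div_mul_eq_mul_div, lt_div_iff₀ (by positivity)]
      have h6 := mul_lt_mul_of_pos_left hs (mul_pos hs0 hlog2)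
      rw [hx] at h6 ⊢
      nlinarith
    linarith

theorem tendsto_union_bound {α r s ρ : ℝ} (hr : 0 ≤ r) (hs : 0 < s) (hρ0 : 0 < ρ)
    (hρ1 : ρ ≤ 1) (h : 2 ^ (s * r) * ρ ^ α < 1) :
    Filter.Tendsto (fun n : ℕ => (⌈(2 : ℝ) ^ (n * r)⌉₊ : ℝ) ^ s * ρ ^ ⌊α * n⌋₊) Filter.atTop
      (nhds 0) := by
  have hgeo : Filter.Tendsto (fun n : ℕ => 2 ^ s * ρ⁻¹ * (2 ^ (s * r) * ρ ^ α) ^ n) Filter.atTop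
      (nhds 0) := by
    have h0 := (tendsto_pow_atTop_nhds_zero_of_lt_one (by positivity) h).const_mul (2 ^ s * ρ⁻¹)
    rwa [mul_zero] at h0
  refine squeeze_zero (fun n => by positivity) (fun n => ?_) hgeo
  have hone : (1 : ℝ) ≤ 2 ^ (n * r) := Real.one_le_rpow one_le_two (by positivity)
  have h1 : (⌈(2 : ℝ) ^ (n * r)⌉₊ : ℝ) ≤ 2 * 2 ^ (n * r) := by
    have := (Nat.ceil_lt_add_one (zero_le_one.trans hone)).le
    linarith
  have h2 : (⌈(2 : ℝ) ^ (n * r)⌉₊ : ℝ) ^ s ≤ 2 ^ s * (2 ^ (s * r)) ^ n := by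
    refine (Real.rpow_le_rpow (Nat.cast_nonneg _) h1 hs.le).trans_eq ?_
    rw [Real.mul_rpow two_pos.le (by positivity), ← Real.rpow_mul two_pos.le,
      ← Real.rpow_natCast, ← Real.rpow_mul two_pos.le]
    ring_nf
  have h3 : ρ ^ ⌊α * n⌋₊ ≤ ρ⁻¹ * (ρ ^ α) ^ n := by
    rw [← Real.rpow_natCast, ← Real.rpow_natCast, ← Real.rpow_mul hρ0.le, ← Real.rpow_neg_one,
      ← Real.rpow_add hρ0]
    refine Real.rpow_le_rpow_of_exponent_ge hρ0 hρ1 ?_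
    linarith [Nat.sub_one_lt_floor (α * n)]
  refine (mul_le_mul h2 h3 (by positivity) (by positivity)).trans_eq ?_
  rw [mul_pow]
  ring

/-- Time sharing with fractions `α` achieves all rates `r k` with `r k < F (1 - δ k) α k`. -/
theorem eventually_exists_code (hK : 0 < K) (hF : 0 < F) {δ : Fin K → ℝ} (hδ0 : ∀ k, 0 ≤ δ k)
    (hδ1 : ∀ k, δ k < 1) (hδ : Antitone δ) {α r : Fin K → ℝ} (hα0 : ∀ k, 0 ≤ α k)
    (hα : ∑ k, α k ≤ 1) (hr0 : ∀ k, 0 ≤ r k) (hr : ∀ k, r k < F * (1 - δ k) * α k)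
    {ε : ℝ} (hε : 0 < ε) :
    ∀ᶠ n : ℕ in Filter.atTop, ∃ (m : Fin K → ℕ)
        (f : (∀ k : Fin K, Fin (m k)) → Fin n → Packet F)
        (φ : Fin K → (Fin n → Option (Packet F)) → ∀ k : Fin K, Fin (m k)),
        (∀ k, (2 : ℝ) ^ ((n : ℝ) * r k) ≤ m k) ∧
        (∀ j k : Fin K, k ≤ j → degErrProb K F n δ m f φ j k ≤ ε) := by
  choose s hs0 hs1 hρ0 hρ1 hdecay using fun k => exists_decay_exponent hF
    (sub_pos.2 (hδ1 k)) (sub_le_self 1 (hδ0 k)) (hr0 k) (hr k)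
  have hlim : Filter.Tendsto (fun n : ℕ => (K : ℝ) * ∑ k, (⌈(2 : ℝ) ^ (n * r k)⌉₊ : ℝ) ^ s k *
      (1 - (1 - δ k) * (1 - ((2 : ℝ) ^ F) ^ (-s k))) ^ ⌊α k * n⌋₊) Filter.atTop (nhds 0) := by
    have h := (tendsto_finsetSum Finset.univ fun k _ =>
      tendsto_union_bound (hr0 k) (hs0 k) (hρ0 k) (hρ1 k) (hdecay k)).const_mul (K : ℝ)
    simpa using h
  filter_upwards [hlim.eventually_lt_const hε] with n hn
  have : Nonempty (Fin K) := ⟨⟨0, hK⟩⟩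
  obtain ⟨b, hb⟩ := exists_fiber_card_ge (τ := Fin n) (fun k => ⌊α k * n⌋₊) (by
    rw [Fintype.card_fin, ← Nat.cast_le (α := ℝ)]
    push_cast
    calc ∑ k, (⌊α k * n⌋₊ : ℝ) ≤ ∑ k, α k * n :=
          Finset.sum_le_sum fun k _ => Nat.floor_le (mul_nonneg (hα0 k) (Nat.cast_nonneg _))
      _ ≤ n := by
          rw [← Finset.sum_mul]
          exact mul_le_of_le_one_left (Nat.cast_nonneg _) hα)
  have : ∀ k, NeZero ⌈(2 : ℝ) ^ (n * r k)⌉₊ := fun k => ⟨(Nat.ceil_pos.2 (by positivity)).ne'⟩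
  obtain ⟨c, hc⟩ := exists_codebook (F := F) (m := fun k => ⌈(2 : ℝ) ^ (n * r k)⌉₊) b hδ0
    (fun k => (hδ1 k).le) hδ (fun k => (hs0 k).le) hs1
  refine ⟨_, encode b c, fun _ => decode b c, fun k => Nat.le_ceil _,
    fun j k hkj => (hc j k hkj).trans (le_trans ?_ hn.le)⟩
  refine mul_le_mul_of_nonneg_left (Finset.sum_le_sum fun k _ => ?_) (Nat.cast_nonneg _)
  exact mul_le_mul_of_nonneg_left (pow_le_pow_of_le_one (hρ0 k).le (hρ1 k) (hb k))
    (by positivity)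

theorem degAchievable_of_sum_le (hK : 0 < K) (hF : 0 < F) {δ : Fin K → ℝ} (hδ0 : ∀ k, 0 ≤ δ k)
    (hδ1 : ∀ k, δ k < 1) (hδ : Antitone δ) {R : Fin K → ℝ} (hR : ∀ k, 0 ≤ R k)
    (h : ∑ k, R k / ((F : ℝ) * (1 - δ k)) ≤ 1) : DegAchievable K F δ R := by
  intro ε hε
  have hF0 : (0 : ℝ) < F := Nat.cast_pos.2 hF
  have hK0 : (0 : ℝ) < K := Nat.cast_pos.2 hK
  have hp : ∀ k, 0 < 1 - δ k := fun k => sub_pos.2 (hδ1 k)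
  have hsum : 0 ≤ ∑ k, R k := Finset.sum_nonneg fun k _ => hR k
  set η := ε / (ε + ∑ k, R k) with hη
  have hη0 : 0 < η := by positivity
  have hη1 : η ≤ 1 := (div_le_one (by positivity)).2 (by linarith)
  have hηR : ∀ k, η * R k ≤ ε := by
    intro k
    rw [hη, div_mul_eq_mul_div, div_le_iff₀ (by positivity)]
    have := Finset.single_le_sum (fun k _ => hR k) (Finset.mem_univ k)
    nlinarith
  have hrate : ∀ k, F * (1 - δ k) * ((1 - η) * (R k / (F * (1 - δ k))) + η / K) =
      (1 - η) * R k + F * (1 - δ k) * (η / K) := by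
    intro k
    have := (hp k).ne'
    field_simp
  have hcode := eventually_exists_code hK hF hδ0 hδ1 hδ
    (α := fun k => (1 - η) * (R k / (F * (1 - δ k))) + η / K) (r := fun k => max (R k - ε) 0)
    (fun k => add_nonneg (mul_nonneg (sub_nonneg.2 hη1)
      (div_nonneg (hR k) (mul_pos hF0 (hp k)).le)) (by positivity)) ?_
    (fun k => le_max_right _ _) (fun k => ?_) hε
  · obtain ⟨n, ⟨m, f, φ, hm, herr⟩, hn⟩ := (hcode.and (Filter.eventually_gt_atTop 0)).exists
    refine ⟨n, hn, m, f, φ, fun k => le_trans ?_ (hm k), herr⟩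
    exact Real.rpow_le_rpow_of_exponent_le one_le_two
      (mul_le_mul_of_nonneg_left (le_max_left _ _) (Nat.cast_nonneg _))
  · rw [Finset.sum_add_distrib, ← Finset.mul_sum]
    have h1 := mul_le_mul_of_nonneg_left h (sub_nonneg.2 hη1)
    have h2 : ∑ _k : Fin K, η / K = η := by
      simp
      field_simp
    linarith
  · have hextra : 0 < F * (1 - δ k) * (η / K) := by
      have := hp k
      positivity
    rw [hrate, max_lt_iff]
    have h1 := hηR k
    have h2 := mul_nonneg (sub_nonneg.2 hη1) (hR k)
    constructor <;> linarith

end Achievability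

/-- **Proposition 1 (degraded message set capacity region of the erasure BC).**
For erasure probabilities `1 > δ₁ ≥ δ₂ ≥ ⋯ ≥ δ_K ≥ 0` and packets of `F` bits, a
nonnegative rate tuple `(R_{{1,…,K}}, …, R_{{K}})` is achievable if and only if
`∑_{k=1}^K R_{{k,…,K}} / (F (1 - δ_k)) ≤ 1`; i.e. the capacity region `𝒞†` is the
set of all nonnegative tuples satisfying this inequality. -/
theorem degraded_message_set_capacity
    (K F : ℕ) (hK : 0 < K) (hF : 0 < F)
    (δ : Fin K → ℝ) (hδ0 : ∀ k, 0 ≤ δ k) (hδ1 : ∀ k, δ k < 1)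
    (hδmono : ∀ j k : Fin K, j ≤ k → δ k ≤ δ j)
    (R : Fin K → ℝ) (hR : ∀ k, 0 ≤ R k) :
    DegAchievable K F δ R ↔
      ∑ k : Fin K, R k / ((F : ℝ) * (1 - δ k)) ≤ 1 :=
  ⟨sum_rate_le_of_degAchievable hF hδ0 hδ1 hδmono,
    degAchievable_of_sum_le hK hF hδ0 hδ1 hδmono hR⟩
end

section
/- Let W_1, ..., W_D be random variables with finite ranges on a common probability space, fix d ∈ {1,...,D}, and let δ ∈ [0,1], F and n positive integers. Let Z = g(W_1,...,W_D) and (X_1,...,X_n) = f(W_1,...,W_D) with each X_t ∈ {0,1}^F, for deterministic functions f, g. Let E_1,...,E_n be i.i.d. Bernoulli(δ) random variables, independent of (W_1,...,W_D), and define Y_t = X_t if E_t = 0 and Y_t = Δ if E_t = 1, for a symbol Δ ∉ {0,1}^F. Then H(W_d) ≤ I(W_d; Z) + n·(1-δ)·F + H(W_d | Y_1,...,Y_n, Z). -/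
open scoped BigOperators
open Classical

/-- Probability of the event `s` under the probability mass function `p` on the
finite sample space `Ω`. -/
noncomputable def probOf {Ω : Type*} [Fintype Ω] (p : Ω → ℝ) (s : Set Ω) : ℝ :=
  ∑ ω : Ω, if ω ∈ s then p ω else 0

/-- Shannon entropy (in bits) of the discrete random variable `X` with finite range,
`H(X) = -∑ₓ P(X = x) log₂ P(X = x)` (with `0 log 0 = 0`, as `Real.logb 2 0 = 0`). -/
noncomputable def entropy {Ω α : Type*} [Fintype Ω] [Fintype α]
    (p : Ω → ℝ) (X : Ω → α) : ℝ :=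
  -∑ x : α, probOf p {ω | X ω = x} * Real.logb 2 (probOf p {ω | X ω = x})

/-- Conditional entropy `H(X|Y) = H(X,Y) - H(Y)`. -/
noncomputable def condEntropy {Ω α β : Type*} [Fintype Ω] [Fintype α] [Fintype β]
    (p : Ω → ℝ) (X : Ω → α) (Y : Ω → β) : ℝ :=
  entropy p (fun ω => (X ω, Y ω)) - entropy p Y

/-- Mutual information `I(X;Y) = H(X) - H(X|Y)`. -/
noncomputable def mutualInfo {Ω α β : Type*} [Fintype Ω] [Fintype α] [Fintype β]
    (p : Ω → ℝ) (X : Ω → α) (Y : Ω → β) : ℝ :=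
  entropy p X - condEntropy p X Y

section ErasureConverse

variable {Ω α β : Type*} [Fintype Ω] [Fintype α] [Fintype β] {p : Ω → ℝ}

lemma probOf_nonneg (hp0 : ∀ ω, 0 ≤ p ω) (s : Set Ω) : 0 ≤ probOf p s :=
  Finset.sum_nonneg fun ω _ => by split_ifs; exacts [hp0 ω, le_rfl]

lemma probOf_mono (hp0 : ∀ ω, 0 ≤ p ω) {s t : Set Ω} (h : s ⊆ t) :
    probOf p s ≤ probOf p t :=
  Finset.sum_le_sum fun ω _ => by
    by_cases hs : ω ∈ s
    · simp [hs, h hs]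
    · simp only [hs, if_false]
      split_ifs
      exacts [hp0 ω, le_rfl]

lemma probOf_pos (hp0 : ∀ ω, 0 ≤ p ω) {s : Set Ω} {ω : Ω} (hω : ω ∈ s) (hp : 0 < p ω) :
    0 < probOf p s := by
  have h := Finset.single_le_sum (f := fun ω => if ω ∈ s then p ω else 0)
    (fun i _ => by split_ifs; exacts [hp0 i, le_rfl]) (Finset.mem_univ ω)
  simp only [hω, if_true] at h
  exact hp.trans_le h

lemma exists_pos_of_probOf_pos {s : Set Ω} (h : 0 < probOf p s) : ∃ ω ∈ s, 0 < p ω := by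
  obtain ⟨ω, -, hω⟩ := Finset.exists_lt_of_sum_lt
    (f := fun _ : Ω => (0 : ℝ)) (g := fun ω => if ω ∈ s then p ω else 0)
    (s := Finset.univ) (by simpa [probOf] using h)
  by_cases hs : ω ∈ s
  · exact ⟨ω, hs, by simpa [hs] using hω⟩
  · simp [hs] at hω

/-- Change of variables for the expectation of a function of `X`. -/
lemma sum_probOf_mul (p : Ω → ℝ) (X : Ω → α) (c : α → ℝ) :
    ∑ x, probOf p {ω | X ω = x} * c x = ∑ ω, p ω * c (X ω) := by
  simp only [probOf, Finset.sum_mul]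
  rw [Finset.sum_comm]
  simp [ite_mul]

lemma entropy_eq_neg_sum (p : Ω → ℝ) (X : Ω → α) :
    entropy p X = -∑ ω, p ω * Real.logb 2 (probOf p {ω' | X ω' = X ω}) := by
  rw [entropy, sum_probOf_mul p X fun x => Real.logb 2 (probOf p {ω | X ω = x})]

/-- The Gibbs inequality. -/
lemma entropy_le_cross_entropy (hp0 : ∀ ω, 0 ≤ p ω) (hp1 : ∑ ω, p ω = 1) (X : Ω → α)
    (q : α → ℝ) (hq0 : ∀ x, 0 ≤ q x) (hq1 : ∑ x, q x ≤ 1)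
    (hq : ∀ ω, 0 < p ω → 0 < q (X ω)) :
    entropy p X ≤ -∑ ω, p ω * Real.logb 2 (q (X ω)) := by
  have hsum : ∑ x, probOf p {ω | X ω = x} = 1 := by
    simpa [hp1] using sum_probOf_mul p X fun _ => 1
  have hlog : 0 < Real.log 2 := Real.log_pos one_lt_two
  rw [entropy, ← sum_probOf_mul p X fun x => Real.logb 2 (q x), neg_le_neg_iff,
    ← sub_nonpos, ← Finset.sum_sub_distrib]
  calc _ ≤ ∑ x, (q x - probOf p {ω | X ω = x}) / Real.log 2 := by
        refine Finset.sum_le_sum fun x _ => ?_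
        rcases (probOf_nonneg hp0 {ω | X ω = x}).eq_or_lt with h | h
        · simp only [← h, zero_mul, sub_zero]
          exact div_nonneg (hq0 x) hlog.le
        · obtain ⟨ω, rfl, hω⟩ := exists_pos_of_probOf_pos h
          have hqx := hq ω hω
          have := Real.log_le_sub_one_of_pos (div_pos hqx h)
          rw [Real.log_div hqx.ne' h.ne'] at this
          rw [Real.logb, Real.logb, ← mul_sub, ← sub_div, ← mul_div_assoc]
          gcongr
          calc _ ≤ _ := mul_le_mul_of_nonneg_left this h.le
            _ = _ := by field_simp
    _ = (∑ x, q x - 1) / Real.log 2 := by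
        rw [← Finset.sum_div, Finset.sum_sub_distrib, hsum]
    _ ≤ 0 := div_nonpos_of_nonpos_of_nonneg (by linarith) hlog.le

lemma entropy_le_of_comp (hp0 : ∀ ω, 0 ≤ p ω) (X : Ω → α) (Y : Ω → β) (φ : α → β)
    (hY : ∀ ω, Y ω = φ (X ω)) : entropy p Y ≤ entropy p X := by
  rw [entropy_eq_neg_sum, entropy_eq_neg_sum, neg_le_neg_iff]
  refine Finset.sum_le_sum fun ω _ => ?_
  rcases (hp0 ω).eq_or_lt with h | h
  · simp [← h]
  · refine mul_le_mul_of_nonneg_left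
      (Real.logb_le_logb_of_le one_lt_two (probOf_pos hp0 (by simp) h)
        (probOf_mono hp0 fun ω' hω' => ?_)) h.le
    simp only [Set.mem_ofPred_eq] at hω' ⊢
    rw [hY, hY, hω']

/-- Splitting the expected logarithm of a product that is positive almost surely. -/
lemma neg_sum_mul_logb_mul (hp0 : ∀ ω, 0 ≤ p ω) (a b : Ω → ℝ)
    (ha : ∀ ω, 0 < p ω → 0 < a ω) (hb : ∀ ω, 0 < p ω → 0 < b ω) :
    -∑ ω, p ω * Real.logb 2 (a ω * b ω) =
      -∑ ω, p ω * Real.logb 2 (a ω) + -∑ ω, p ω * Real.logb 2 (b ω) := by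
  rw [← neg_add, ← Finset.sum_add_distrib]
  congr 1
  refine Finset.sum_congr rfl fun ω _ => ?_
  rcases (hp0 ω).eq_or_lt with h | h
  · simp [← h]
  · rw [Real.logb_mul (ha ω h).ne' (hb ω h).ne', mul_add]

lemma entropy_prodMk_le_add (hp0 : ∀ ω, 0 ≤ p ω) (hp1 : ∑ ω, p ω = 1)
    (X : Ω → α) (Y : Ω → β) :
    entropy p (fun ω => (X ω, Y ω)) ≤ entropy p X + entropy p Y := by
  rw [entropy_eq_neg_sum p X, entropy_eq_neg_sum p Y, ← neg_sum_mul_logb_mul hp0 _ _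
    (fun ω => probOf_pos hp0 (by simp)) (fun ω => probOf_pos hp0 (by simp))]
  refine entropy_le_cross_entropy hp0 hp1 (fun ω => (X ω, Y ω))
    (fun z => probOf p {ω | X ω = z.1} * probOf p {ω | Y ω = z.2})
    (fun z => mul_nonneg (probOf_nonneg hp0 _) (probOf_nonneg hp0 _)) ?_
    (fun ω h => mul_pos (probOf_pos hp0 (by simp) h) (probOf_pos hp0 (by simp) h))
  have hX := sum_probOf_mul p X fun _ => 1
  have hY := sum_probOf_mul p Y fun _ => 1
  simp only [mul_one, hp1] at hX hY
  simp only [Fintype.sum_prod_type]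
  rw [← Fintype.sum_mul_sum, hX, hY, one_mul]

lemma entropy_prodMk_eq_add_of_indep (hp0 : ∀ ω, 0 ≤ p ω) (X : Ω → α) (Y : Ω → β)
    (h : ∀ x y, probOf p {ω | X ω = x ∧ Y ω = y} =
      probOf p {ω | X ω = x} * probOf p {ω | Y ω = y}) :
    entropy p (fun ω => (X ω, Y ω)) = entropy p X + entropy p Y := by
  rw [entropy_eq_neg_sum p X, entropy_eq_neg_sum p Y, ← neg_sum_mul_logb_mul hp0 _ _
    (fun ω => probOf_pos hp0 (by simp)) (fun ω => probOf_pos hp0 (by simp)),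
    entropy_eq_neg_sum]
  simp only [Prod.mk.injEq, h]

lemma probOf_comp_and (p : Ω → ℝ) (V : Ω → α) (S : α → Prop) (Q : Ω → Prop) :
    probOf p {ω | S (V ω) ∧ Q ω} =
      ∑ w, if S w then probOf p {ω | V ω = w ∧ Q ω} else 0 := by
  have h : ∀ w, (if S w then probOf p {ω | V ω = w ∧ Q ω} else 0) =
      ∑ ω, if S w ∧ V ω = w ∧ Q ω then p ω else 0 := fun w => by
    by_cases hS : S w
    · simp only [hS, if_true, true_and, probOf, Set.mem_ofPred_eq]
      exact Finset.sum_congr rfl fun ω _ => by congr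
    · simp [hS]
  rw [Finset.sum_congr rfl fun w _ => h w, Finset.sum_comm]
  refine Finset.sum_congr rfl fun ω _ => ?_
  rw [Finset.sum_eq_single (V ω)]
  · simp
  · intro w _ hw
    simp [hw.symm]
  · simp

lemma probOf_comp_and_eq_mul (p : Ω → ℝ) {ι γ : Type*} (V : Ω → α) (Y : Ω → ι)
    (h : ∀ x y, probOf p {ω | V ω = x ∧ Y ω = y} =
      probOf p {ω | V ω = x} * probOf p {ω | Y ω = y}) (φ : α → γ) (c : γ) (y : ι) :
    probOf p {ω | φ (V ω) = c ∧ Y ω = y} =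
      probOf p {ω | φ (V ω) = c} * probOf p {ω | Y ω = y} := by
  have h1 := probOf_comp_and p V (fun w => φ w = c) (fun _ => True)
  simp only [and_true] at h1
  rw [probOf_comp_and p V (fun w => φ w = c), h1, Finset.sum_mul]
  exact Finset.sum_congr rfl fun w _ => by rw [ite_mul, zero_mul, h]

end ErasureConverse

section ErasurePattern

variable {Ω : Type*} [Fintype Ω] {p : Ω → ℝ} {n : ℕ} {δ : ℝ}

/-- The probability that slot `t` is not erased. -/
lemma sum_unerased_slot (E : Ω → Fin n → Bool)
    (hE : ∀ e : Fin n → Bool,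
      probOf p {ω | E ω = e} = ∏ t, (if e t then δ else 1 - δ)) (t : Fin n) :
    ∑ ω, p ω * (if E ω t then 0 else 1) = 1 - δ := by
  rw [← sum_probOf_mul p E fun e => if e t then 0 else 1]
  have h : ∀ e : Fin n → Bool, probOf p {ω | E ω = e} * (if e t then 0 else 1) =
      ∏ s, if s = t then (if e s then 0 else 1 - δ) else (if e s then δ else 1 - δ) := by
    intro e
    rw [hE, ← Finset.mul_prod_erase _ _ (Finset.mem_univ t),
      ← Finset.mul_prod_erase _ _ (Finset.mem_univ t)]
    rw [Finset.prod_congr rfl (g := fun s => if e s then δ else 1 - δ)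
      (s₁ := Finset.univ.erase t) (s₂ := Finset.univ.erase t)
      (f := fun s => if s = t then (if e s then 0 else 1 - δ) else (if e s then δ else 1 - δ))
      (fun s hs => by simp [Finset.ne_of_mem_erase hs])]
    cases e t <;> simp
  rw [Finset.sum_congr rfl fun e _ => h e, ← Fintype.prod_sum
    (f := fun s b => if s = t then (if b = true then 0 else 1 - δ)
      else (if b = true then δ else 1 - δ))]
  simp

lemma entropy_erasure_output_le (hp0 : ∀ ω, 0 ≤ p ω) (hp1 : ∑ ω, p ω = 1)
    (hδ0 : 0 ≤ δ) (hδ1 : δ ≤ 1) {F : ℕ} (E : Ω → Fin n → Bool)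
    (hE : ∀ e : Fin n → Bool,
      probOf p {ω | E ω = e} = ∏ t, (if e t then δ else 1 - δ))
    (Y : Ω → Fin n → Option (Fin F → Bool)) (hY : ∀ ω t, (Y ω t).isNone = E ω t) :
    entropy p Y ≤ entropy p E + n * (1 - δ) * F := by
  let r : Option (Fin F → Bool) → ℝ := fun o => if o.isNone then δ else (1 - δ)
  let u : Option (Fin F → Bool) → ℝ := fun o => if o.isNone then 1 else (2 ^ F)⁻¹
  have hr : ∀ o, 0 ≤ r o := fun o => by dsimp only [r]; split_ifs <;> linarith
  have hu : ∀ o, 0 < u o := fun o => by dsimp only [u]; split_ifs <;> positivity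
  have hrE : ∀ ω, ∏ t, r (Y ω t) = probOf p {ω' | E ω' = E ω} := fun ω => by
    rw [hE]; simp only [r, hY]
  have key := entropy_le_cross_entropy hp0 hp1 Y (fun y => (∏ t, r (y t)) * ∏ t, u (y t))
    (fun y => mul_nonneg (Finset.prod_nonneg fun t _ => hr _)
      (Finset.prod_nonneg fun t _ => (hu _).le)) ?_
    (fun ω h => mul_pos (by rw [hrE]; exact probOf_pos hp0 (by simp) h)
      (Finset.prod_pos fun t _ => hu _))
  · refine key.trans_eq ?_
    rw [neg_sum_mul_logb_mul hp0 _ _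
      (fun ω h => by rw [hrE]; exact probOf_pos hp0 (by simp) h)
      (fun ω _ => Finset.prod_pos fun t _ => hu _), entropy_eq_neg_sum p E]
    simp only [hrE]
    congr 1
    have hlog : ∀ ω, p ω * Real.logb 2 (∏ t, u (Y ω t)) =
        -∑ t, p ω * (if E ω t then 0 else 1) * F := fun ω => by
      rw [Real.logb_prod _ _ fun t _ => (hu _).ne', Finset.mul_sum, ← Finset.sum_neg_distrib]
      refine Finset.sum_congr rfl fun t _ => ?_
      simp only [u, hY]
      split_ifs <;> simp [Real.logb_inv, Real.logb_pow]
    rw [Finset.sum_congr rfl fun ω _ => hlog ω, Finset.sum_neg_distrib, neg_neg,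
      Finset.sum_comm]
    simp only [← Finset.sum_mul, sum_unerased_slot E hE]
    rw [Finset.sum_const, Finset.card_univ, Fintype.card_fin, nsmul_eq_mul]
  · simp only [← Finset.prod_mul_distrib]
    rw [← Fintype.prod_sum (f := fun _ o => r o * u o)]
    have h : ∑ o, r o * u o = 1 := by
      simp only [Fintype.sum_option, r, u]
      simp
      field_simp
      ring
    simp [h]

end ErasurePattern

/-- **Converse chain for the cache-aided erasure broadcast channel.**  Let
`W₁,…,W_D` be random variables with finite ranges, `Z = g(W₁,…,W_D)` a cache
content, `(X₁,…,X_n) = f(W₁,…,W_D)` a channel input sequence of `F`-bit packets,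
and let `E₁,…,E_n` be i.i.d. Bernoulli(`δ`) erasure indicators independent of
`(W₁,…,W_D)`, producing outputs `Y_t = X_t` if `E_t = 0` and the erasure symbol
(`none`) if `E_t = 1`.  Then for every message index `d`,
`H(W_d) ≤ I(W_d; Z) + n (1-δ) F + H(W_d | Y₁,…,Y_n, Z)`. -/
theorem converse_chain_erasure_bc
    {Ω : Type*} [Fintype Ω] (p : Ω → ℝ)
    (hp0 : ∀ ω, 0 ≤ p ω) (hp1 : ∑ ω : Ω, p ω = 1)
    {D : ℕ} {α : Fin D → Type*} [∀ d, Fintype (α d)]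
    (W : ∀ d : Fin D, Ω → α d) (d : Fin D)
    (n F : ℕ) (hn : 0 < n) (hF : 0 < F)
    (δ : ℝ) (hδ0 : 0 ≤ δ) (hδ1 : δ ≤ 1)
    {γ : Type*} [Fintype γ]
    (g : (∀ d : Fin D, α d) → γ)
    (f : (∀ d : Fin D, α d) → Fin n → (Fin F → Bool))
    (E : Ω → Fin n → Bool)
    (hEdist : ∀ e : Fin n → Bool,
      probOf p {ω | E ω = e} = ∏ t : Fin n, (if e t then δ else 1 - δ))
    (hindep : ∀ (w : ∀ d : Fin D, α d) (e : Fin n → Bool),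
      probOf p {ω | (∀ d, W d ω = w d) ∧ E ω = e} =
        probOf p {ω | ∀ d, W d ω = w d} * probOf p {ω | E ω = e})
    (Z : Ω → γ) (hZ : ∀ ω, Z ω = g (fun d => W d ω))
    (Y : Ω → Fin n → Option (Fin F → Bool))
    (hY : ∀ ω t, Y ω t =
      if E ω t then none else some (f (fun d => W d ω) t)) :
    entropy p (W d) ≤
      mutualInfo p (W d) Z + (n : ℝ) * (1 - δ) * (F : ℝ) +
        condEntropy p (W d) (fun ω => (Y ω, Z ω)) := by
  have hYE : ∀ ω t, (Y ω t).isNone = E ω t := fun ω t => by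
    rw [hY]; cases E ω t <;> simp
  have hup := entropy_prodMk_le_add hp0 hp1 Y Z
  have hYH := entropy_erasure_output_le hp0 hp1 hδ0 hδ1 E hEdist Y hYE
  have hdet : entropy p (fun ω => ((W d ω, Z ω), E ω)) ≤
      entropy p (fun ω => (W d ω, (Y ω, Z ω))) :=
    entropy_le_of_comp hp0 _ _ (fun v => ((v.1, v.2.2), fun t => (v.2.1 t).isNone))
      fun ω => by simp [hYE]
  have hind : entropy p (fun ω => ((W d ω, Z ω), E ω)) =
      entropy p (fun ω => (W d ω, Z ω)) + entropy p E := by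
    refine entropy_prodMk_eq_add_of_indep hp0 _ _ fun x e => ?_
    simp only [hZ]
    exact probOf_comp_and_eq_mul p (fun ω d => W d ω) E
      (fun w e => by simpa only [funext_iff (f := fun d => W d _)] using hindep w e)
      (fun w => (w d, g w)) x e
  rw [mutualInfo, condEntropy, condEntropy]
  linarith
end
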